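/- arXiv:2211.14833 — 2 statements merged into one kernel-verified Lean document; each statement's English description precedes it below -/
import Mathlib

section
/- Consider the linear program with real variables u_i ∈ [0,1] for each vertex i ∈ V and x_{ij} ≥ 0 for each edge {i,j} ∈ E (with x_{ij} = x_{ji}): minimize Σ_{i ∈ V} u_i subject to, for every i ∈ V, Σ_{j ∈ N(i)} u_j + k − |N(i)| ≤ Σ_{j ∈ N(i)} x_{ij} + (k − |N(i)|)·u_i, and for every edge {i,j} ∈ E, x_{ij} ≤ u_i and x_{ij} ≤ u_j. The optimal value of this linear program equals n − |C_k(G)|, where n = |V| and C_k(G) is the k-core of G. -/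
open Finset

/-- `S` is a `k`-subcore of `G`: every vertex of `S` has at least `k` neighbors inside `S`. -/
def IsKSubcore {V : Type*} [Fintype V] [DecidableEq V] (G : SimpleGraph V)
    [DecidableRel G.Adj] (k : ℕ) (S : Finset V) : Prop :=
  ∀ i ∈ S, k ≤ (G.neighborFinset i ∩ S).card

/-- The `k`-core of `G \ W` (the subgraph of `G` induced by `V \ W`), regarded as a
subset of `V`: the union of all `k`-subcores of `G` that are disjoint from `W`. -/
noncomputable def kCoreDel {V : Type*} [Fintype V] [DecidableEq V] (G : SimpleGraph V)
    [DecidableRel G.Adj] (k : ℕ) (W : Finset V) : Finset V :=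
  @Finset.filter V (fun v => ∃ S : Finset V, IsKSubcore G k S ∧ Disjoint S W ∧ v ∈ S)
    (Classical.decPred _) Finset.univ

/-- The `k`-core of `G`: the union of all `k`-subcores of `G`. -/
noncomputable def kCore {V : Type*} [Fintype V] [DecidableEq V] (G : SimpleGraph V)
    [DecidableRel G.Adj] (k : ℕ) : Finset V :=
  kCoreDel G k ∅

theorem mem_kCore_iff' {V : Type*} [Fintype V] [DecidableEq V] (G : SimpleGraph V)
    [DecidableRel G.Adj] (k : ℕ) (v : V) :
    v ∈ kCore G k ↔ ∃ S : Finset V, IsKSubcore G k S ∧ v ∈ S := by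
  simp [kCore, kCoreDel]

theorem kCore_isKSubcore {V : Type*} [Fintype V] [DecidableEq V] (G : SimpleGraph V)
    [DecidableRel G.Adj] (k : ℕ) : IsKSubcore G k (kCore G k) := by
  intro i hi
  obtain ⟨S, hS, hiS⟩ := (mem_kCore_iff' G k i).1 hi
  refine (hS i hiS).trans (Finset.card_le_card ?_)
  exact Finset.inter_subset_inter_left
    (fun v hv => (mem_kCore_iff' G k v).2 ⟨S, hS, hv⟩)

/-- the optimal value of the LP relaxation (with redundant constraints
dropped) equals `n - |C_k(G)|`. -/
theorem lp_value_eq_complement_kCore {V : Type*} [Fintype V] [DecidableEq V]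
    (G : SimpleGraph V) [DecidableRel G.Adj] (k : ℕ) (hk : 0 < k) :
    IsLeast {s : ℝ | ∃ (u : V → ℝ) (x : V → V → ℝ),
      (∀ i, 0 ≤ u i ∧ u i ≤ 1) ∧
      (∀ i j, G.Adj i j → 0 ≤ x i j) ∧
      (∀ i j, G.Adj i j → x i j = x j i) ∧
      (∀ i, (∑ j ∈ G.neighborFinset i, u j) + (k : ℝ) - (G.degree i : ℝ) ≤
        (∑ j ∈ G.neighborFinset i, x i j) + ((k : ℝ) - (G.degree i : ℝ)) * u i) ∧
      (∀ i j, G.Adj i j → x i j ≤ u i) ∧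
      (∀ i j, G.Adj i j → x i j ≤ u j) ∧
      s = ∑ i, u i}
      ((Fintype.card V : ℝ) - ((kCore G k).card : ℝ)) := by
  constructor
  · refine ⟨fun i => if i ∈ kCore G k then 0 else 1,
      fun i j => (if i ∈ kCore G k then 0 else 1) * (if j ∈ kCore G k then 0 else 1),
      ?_, ?_, ?_, ?_, ?_, ?_, ?_⟩
    · intro i; dsimp only; split_ifs <;> norm_num
    · intro i j _; dsimp only; split_ifs <;> norm_num
    · intro i j _; exact mul_comm _ _
    · intro i
      by_cases hi : i ∈ kCore G k
      · have h : ((k : ℕ) : ℝ) ≤ ((G.neighborFinset i ∩ kCore G k).card : ℝ) := by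
          exact_mod_cast kCore_isKSubcore G k i hi
        have h2 : (∑ j ∈ G.neighborFinset i, (if j ∈ kCore G k then (0 : ℝ) else 1))
            + ((G.neighborFinset i ∩ kCore G k).card : ℝ) = (G.degree i : ℝ) := by
          rw [← Finset.filter_mem_eq_inter, Finset.card_filter, Nat.cast_sum,
            ← Finset.sum_add_distrib, ← G.card_neighborFinset_eq_degree, Finset.card_eq_sum_ones,
            Nat.cast_sum]
          refine Finset.sum_congr rfl fun j _ => ?_
          split_ifs <;> simp
        simp only [hi, if_true, zero_mul, mul_zero, Finset.sum_const_zero]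
        linarith
      · simp only [hi, if_false, one_mul, mul_one]
        linarith
    · intro i j _; dsimp only; split_ifs <;> norm_num
    · intro i j _; dsimp only; split_ifs <;> norm_num
    · have : ((kCore G k).card : ℝ) = ∑ i, (if i ∈ kCore G k then (1 : ℝ) else 0) := by
        simp
      rw [this, ← Finset.card_univ, Finset.card_eq_sum_ones, Nat.cast_sum,
        ← Finset.sum_sub_distrib]
      refine Finset.sum_congr rfl fun j _ => ?_
      by_cases hj : j ∈ kCore G k <;> simp [hj]
  · rintro s ⟨u, x, hu, -, -, hc, hxi, hxj, rfl⟩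
    let S : Finset V := Finset.univ.filter fun i => u i < 1
    have hS : IsKSubcore G k S := by
      intro i hi
      have hi1 : u i < 1 := (Finset.mem_filter.1 hi).2
      have h1 : (∑ j ∈ G.neighborFinset i, (1 - u i - u j + x i j)) ≤
          ∑ j ∈ G.neighborFinset i, (if j ∈ S then (1 - u i) else 0) := by
        refine Finset.sum_le_sum fun j hj => ?_
        have hadj : G.Adj i j := (G.mem_neighborFinset i j).1 hj
        have a := hxi i j hadj
        have b := hxj i j hadj
        split_ifs with h
        · linarith
        · have : ¬ u j < 1 := fun h' => h (Finset.mem_filter.2 ⟨Finset.mem_univ _, h'⟩)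
          linarith
      have h2 : (∑ j ∈ G.neighborFinset i, (if j ∈ S then (1 - u i) else 0)) =
          ((G.neighborFinset i ∩ S).card : ℝ) * (1 - u i) := by
        rw [← Finset.sum_filter, Finset.filter_mem_eq_inter, Finset.sum_const, nsmul_eq_mul]
      have h3 : (∑ j ∈ G.neighborFinset i, (1 - u i - u j + x i j)) =
          (G.degree i : ℝ) * (1 - u i) - (∑ j ∈ G.neighborFinset i, u j)
            + ∑ j ∈ G.neighborFinset i, x i j := by
        rw [Finset.sum_add_distrib, Finset.sum_sub_distrib, Finset.sum_const, nsmul_eq_mul,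
          G.card_neighborFinset_eq_degree]
      have h4 := hc i
      have h5 : (k : ℝ) * (1 - u i) ≤ ((G.neighborFinset i ∩ S).card : ℝ) * (1 - u i) := by
        linarith
      have h6 := le_of_mul_le_mul_right h5 (by linarith)
      exact_mod_cast h6
    have hsub : S ⊆ kCore G k := fun v hv => (mem_kCore_iff' G k v).2 ⟨S, hS, hv⟩
    have hcard : (S.card : ℝ) ≤ ((kCore G k).card : ℝ) := by
      exact_mod_cast Finset.card_le_card hsub
    have h7 : ∑ i, (1 - u i) ≤ (S.card : ℝ) := by
      rw [Finset.card_filter, Nat.cast_sum]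
      refine Finset.sum_le_sum fun i _ => ?_
      have := hu i
      split_ifs <;> push_cast <;> linarith
    rw [Finset.sum_sub_distrib, Finset.sum_const, nsmul_eq_mul, Finset.card_univ] at h7
    linarith
end

section
/- Let b be a positive integer and assume that for every S ⊆ V with |S| < b one has |C_k(G \ S)| ≥ b − |S| (removing fewer than b vertices together with their followers cannot exhaust the budget). Then there exists W* ⊆ V with |W*| = b attaining the minimum of |C_k(G \ W)| over all W ⊆ V with |W| = b, such that |W* ∩ J_u| ≤ 1 for every u ∈ V; i.e., the cascade inequalities Σ_{j ∈ J_u} w_j ≤ 1 are satisfied by some optimal solution of the Collapsed k-Core Problem. -/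
open Finset

theorem mem_kCoreDel_iff {V : Type*} [Fintype V] [DecidableEq V] (G : SimpleGraph V)
    [DecidableRel G.Adj] (k : ℕ) (W : Finset V) (v : V) :
    v ∈ kCoreDel G k W ↔ ∃ S : Finset V, IsKSubcore G k S ∧ Disjoint S W ∧ v ∈ S := by
  simp [kCoreDel]

theorem kCoreDel_anti {V : Type*} [Fintype V] [DecidableEq V] (G : SimpleGraph V)
    [DecidableRel G.Adj] (k : ℕ) {W W' : Finset V} (h : W ⊆ W') :
    kCoreDel G k W' ⊆ kCoreDel G k W := by
  intro v hv
  rw [mem_kCoreDel_iff] at hv ⊢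
  obtain ⟨S, h1, h2, h3⟩ := hv
  exact ⟨S, h1, h2.mono_right h, h3⟩

theorem kCoreDel_disj {V : Type*} [Fintype V] [DecidableEq V] (G : SimpleGraph V)
    [DecidableRel G.Adj] (k : ℕ) (W : Finset V) : Disjoint (kCoreDel G k W) W := by
  rw [Finset.disjoint_left]
  intro v hv
  rw [mem_kCoreDel_iff] at hv
  obtain ⟨S, h1, h2, h3⟩ := hv
  exact Finset.disjoint_left.1 h2 h3

/-- if removing any fewer than `b` vertices leaves a `k`-core with at
least `b - |S|` vertices, then some optimal solution of the Collapsed `k`-Core Problem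
removes at most one vertex from each follower set `J_u`. -/
theorem cascade_inequalities_valid {V : Type*} [Fintype V] [DecidableEq V]
    (G : SimpleGraph V) [DecidableRel G.Adj] (k b : ℕ) (hk : 0 < k) (hb : 0 < b)
    (hbn : b ≤ Fintype.card V)
    (hcap : ∀ S : Finset V, S.card < b → b - S.card ≤ (kCoreDel G k S).card) :
    ∃ W : Finset V, W.card = b ∧
      (∀ W' : Finset V, W'.card = b →
        (kCoreDel G k W).card ≤ (kCoreDel G k W').card) ∧
      (∀ u : V, (W ∩ ((Finset.univ : Finset V) \ kCoreDel G k {u})).card ≤ 1) := by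
  obtain ⟨W, hW, hmin⟩ := Finset.exists_min_image
    (Finset.powersetCard b (Finset.univ : Finset V)) (fun W => (kCoreDel G k W).card)
    (Finset.powersetCard_nonempty.2 (by simpa using hbn))
  have hWc : W.card = b := (Finset.mem_powersetCard.1 hW).2
  have hmin' : ∀ W' : Finset V, W'.card = b →
      (kCoreDel G k W).card ≤ (kCoreDel G k W').card := fun W' h =>
    hmin W' (Finset.mem_powersetCard.2 ⟨Finset.subset_univ _, h⟩)
  refine ⟨W, hWc, hmin', fun u => ?_⟩
  by_contra hlt
  push Not at hlt
  set J := (Finset.univ : Finset V) \ kCoreDel G k {u} with hJ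
  set W1 := insert u (W \ J) with hW1
  have hc := Finset.card_inter_add_card_sdiff W J
  have hW1c : W1.card < b := by
    have := Finset.card_insert_le u (W \ J)
    rw [← hW1] at this
    omega
  have hsub : kCoreDel G k W1 ⊆ kCoreDel G k W := by
    intro v hv
    rw [mem_kCoreDel_iff] at hv ⊢
    obtain ⟨S, h1, h2, h3⟩ := hv
    refine ⟨S, h1, ?_, h3⟩
    rw [Finset.disjoint_left] at h2 ⊢
    intro x hx hxW
    have hxu : x ∈ kCoreDel G k {u} := by
      rw [mem_kCoreDel_iff]
      refine ⟨S, h1, ?_, hx⟩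
      rw [Finset.disjoint_singleton_right]
      intro hu
      exact h2 hu (Finset.mem_insert_self _ _)
    refine h2 hx (Finset.mem_insert_of_mem ?_)
    simp [hJ, hxW, hxu]
  obtain ⟨T, hT, hTc⟩ := Finset.exists_subset_card_eq (hcap W1 hW1c)
  have hd : Disjoint W1 T := ((kCoreDel_disj G k W1).mono_left hT).symm
  have hcard : (W1 ∪ T).card = b := by
    rw [Finset.card_union_of_disjoint hd]
    omega
  have hle := hmin' _ hcard
  have hss : kCoreDel G k (W1 ∪ T) ⊂ kCoreDel G k W := by
    obtain ⟨t, ht⟩ : T.Nonempty := Finset.card_pos.1 (by omega)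
    rw [Finset.ssubset_iff_of_subset
      ((kCoreDel_anti G k Finset.subset_union_left).trans hsub)]
    exact ⟨t, hsub (hT ht), fun h =>
      Finset.disjoint_left.1 (kCoreDel_disj G k _) h (Finset.mem_union_right _ ht)⟩
  exact absurd (Finset.card_lt_card hss) (not_lt.2 hle)
end
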